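/- arXiv:1204.4290 — 2 statements merged into one kernel-verified Lean document; each statement's English description precedes it below -/
import Mathlib

section
/- Uniqueness of the 𝔭₂-invariant contravariant metric on the region x·x < 0: let U = {x ∈ ℝ⁴ : x·x < 0}. If h : U → (symmetric 4×4 real matrices), x ↦ (h^{μν}(x)), is smooth and satisfies (ℒ_ξ h)^{μν} = 0 on U for every 𝔭₂ vector field ξ, then there exists a constant C ∈ ℝ such that h^{μν}(x) = C · (x·x) x^μ x^ν for all x ∈ U. -/
noncomputable section

open scoped BigOperators

/-- The Minkowski metric η = diag(1,−1,−1,−1), as a function of two indices. -/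
def etaF : Fin 4 → Fin 4 → ℝ := fun μ ν => if μ = ν then (if μ = 0 then 1 else -1) else 0

/-- The Minkowski product x·y = η_{μν} x^μ y^ν. -/
def mdot (x y : Fin 4 → ℝ) : ℝ := ∑ μ, ∑ ν, etaF μ ν * x μ * y ν

/-- The lowered index x_μ = η_{μν} x^ν. -/
def lowr (x : Fin 4 → ℝ) (μ : Fin 4) : ℝ := ∑ ν, etaF μ ν * x ν

/-- The partial derivative ∂_λ f (x). -/
def pdv (f : (Fin 4 → ℝ) → ℝ) (lam : Fin 4) (x : Fin 4 → ℝ) : ℝ :=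
  fderiv ℝ f x (Pi.single lam 1)

/-- A ∈ 𝔰𝔬(1,3), i.e. Aᵀη + ηA = 0, written componentwise. -/
def so13 (A : Fin 4 → Fin 4 → ℝ) : Prop :=
  ∀ μ ν, (∑ κ, A κ μ * etaF κ ν) + (∑ κ, etaF μ κ * A κ ν) = 0

/-- The 𝔭₂ vector field ξ(x) = A x + (b·x) x. -/
def xiP2 (A : Fin 4 → Fin 4 → ℝ) (b : Fin 4 → ℝ) (x : Fin 4 → ℝ) : Fin 4 → ℝ :=
  fun μ => (∑ ν, A μ ν * x ν) + mdot b x * x μ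

/-- Lie derivative of a covariant symmetric 2-tensor field g along a vector field ξ:
  (ℒ_ξ g)_{μν} = ξ^λ ∂_λ g_{μν} + g_{μλ} ∂_ν ξ^λ + g_{λν} ∂_μ ξ^λ. -/
def lieG (ξf : (Fin 4 → ℝ) → Fin 4 → ℝ) (g : (Fin 4 → ℝ) → Fin 4 → Fin 4 → ℝ)
    (x : Fin 4 → ℝ) (μ ν : Fin 4) : ℝ :=
  (∑ lam, ξf x lam * pdv (fun y => g y μ ν) lam x)
  + (∑ lam, g x μ lam * pdv (fun y => ξf y lam) ν x)
  + (∑ lam, g x lam ν * pdv (fun y => ξf y lam) μ x)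

/-- Lie derivative of a contravariant symmetric 2-tensor field h along a vector field ξ:
  (ℒ_ξ h)^{μν} = ξ^λ ∂_λ h^{μν} − h^{μλ} ∂_λ ξ^ν − h^{λν} ∂_λ ξ^μ. -/
def lieH (ξf : (Fin 4 → ℝ) → Fin 4 → ℝ) (h : (Fin 4 → ℝ) → Fin 4 → Fin 4 → ℝ)
    (x : Fin 4 → ℝ) (μ ν : Fin 4) : ℝ :=
  (∑ lam, ξf x lam * pdv (fun y => h y μ ν) lam x)
  - (∑ lam, h x μ lam * pdv (fun y => ξf y ν) lam x)
  - (∑ lam, h x lam ν * pdv (fun y => ξf y μ) lam x)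

/-- Lie derivative of a connection Γ^μ_{νρ} along a vector field ξ ([ℒ_ξ, ∇]):
  ξ^λ ∂_λ Γ^μ_{νρ} − Γ^λ_{νρ} ∂_λ ξ^μ + Γ^μ_{λρ} ∂_ν ξ^λ + Γ^μ_{νλ} ∂_ρ ξ^λ + ∂_ν ∂_ρ ξ^μ. -/
def lieConn (ξf : (Fin 4 → ℝ) → Fin 4 → ℝ)
    (Γ : (Fin 4 → ℝ) → Fin 4 → Fin 4 → Fin 4 → ℝ)
    (x : Fin 4 → ℝ) (μ ν ρ : Fin 4) : ℝ :=
  (∑ lam, ξf x lam * pdv (fun y => Γ y μ ν ρ) lam x)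
  - (∑ lam, Γ x lam ν ρ * pdv (fun y => ξf y μ) lam x)
  + (∑ lam, Γ x μ lam ρ * pdv (fun y => ξf y lam) ν x)
  + (∑ lam, Γ x μ ν lam * pdv (fun y => ξf y lam) ρ x)
  + pdv (fun y => pdv (fun z => ξf z μ) ρ y) ν x

/-- The canonical degenerate covariant metric g_{μν}(x) = (x_μ x_ν − (x·x) η_{μν})/(x·x)². -/
def gC (x : Fin 4 → ℝ) (μ ν : Fin 4) : ℝ :=
  (lowr x μ * lowr x ν - mdot x x * etaF μ ν) / (mdot x x) ^ 2

/-- The canonical degenerate contravariant metric h^{μν}(x) = (x·x) x^μ x^ν. -/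
def hC (x : Fin 4 → ℝ) (μ ν : Fin 4) : ℝ := mdot x x * x μ * x ν

/-- The canonical connection Γ^μ_{νλ}(x) = −(x_ν δ^μ_λ + δ^μ_ν x_λ)/(x·x). -/
def GammaC (x : Fin 4 → ℝ) (μ ν lam : Fin 4) : ℝ :=
  -(lowr x ν * (if μ = lam then 1 else 0) + (if μ = ν then 1 else 0) * lowr x lam) / mdot x x

/-- The diagonal entries of η. -/
def epsD (k : Fin 4) : ℝ := if k = 0 then 1 else -1

lemma etaF_eq (k l : Fin 4) : etaF k l = if k = l then epsD k else 0 := rfl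

lemma epsD_sq (k : Fin 4) : epsD k * epsD k = 1 := by
  unfold epsD; split_ifs <;> norm_num

lemma mdot_eq (x y : Fin 4 → ℝ) : mdot x y = ∑ k, epsD k * x k * y k := by
  simp [mdot, etaF_eq]

lemma lowr_eq (x : Fin 4 → ℝ) (k : Fin 4) : lowr x k = epsD k * x k := by
  simp [lowr, etaF_eq]

lemma pdv_xi (A : Fin 4 → Fin 4 → ℝ) (b x : Fin 4 → ℝ) (ν lam : Fin 4) :
    pdv (fun y => xiP2 A b y ν) lam x
      = A ν lam + epsD lam * b lam * x ν + mdot b x * (if lam = ν then 1 else 0) := by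
  have hc : ∀ i : Fin 4, HasFDerivAt (fun y : Fin 4 → ℝ => y i)
      (ContinuousLinearMap.proj (R := ℝ) i) x := fun i =>
    (ContinuousLinearMap.proj (R := ℝ) (φ := fun _ : Fin 4 => ℝ) i).hasFDerivAt
  have h1 : HasFDerivAt (fun y : Fin 4 → ℝ => ∑ k, A ν k * y k)
      (∑ k, A ν k • ContinuousLinearMap.proj (R := ℝ) k) x :=
    HasFDerivAt.fun_sum fun k _ => (hc k).const_mul (A ν k)
  have h2 : HasFDerivAt (fun y : Fin 4 → ℝ => ∑ k, epsD k * b k * y k)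
      (∑ k, (epsD k * b k) • ContinuousLinearMap.proj (R := ℝ) k) x :=
    HasFDerivAt.fun_sum fun k _ => (hc k).const_mul (epsD k * b k)
  have h3 := h1.add (h2.mul (hc ν))
  unfold pdv xiP2
  simp only [mdot_eq]
  erw [h3.fderiv]
  simp [Pi.single_apply, eq_comm]
  ring

lemma struct_eq (h : (Fin 4 → ℝ) → Fin 4 → Fin 4 → ℝ) (x : Fin 4 → ℝ) (μ ν k : Fin 4)
    (hh : lieH (xiP2 (fun _ _ => 0) (Pi.single k 1)) h x μ ν = 0) :
    x k * ((∑ l, x l * pdv (fun y => h y μ ν) l x) - 2 * h x μ ν)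
      = h x μ k * x ν + h x k ν * x μ := by
  unfold lieH at hh
  simp only [pdv_xi] at hh
  simp [xiP2, mdot_eq, Pi.single_apply, mul_add, Finset.sum_add_distrib, mul_assoc,
    ← Finset.mul_sum] at hh
  linear_combination epsD k * hh + (-x k * ((∑ l, x l * pdv (fun y => h y μ ν) l x) - 2 * h x μ ν)
      + h x μ k * x ν + h x k ν * x μ) * epsD_sq k

lemma rank_one (h : Fin 4 → Fin 4 → ℝ) (w : Fin 4 → Fin 4 → ℝ) (x : Fin 4 → ℝ)
    (hs : ∀ μ ν, h μ ν = h ν μ)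
    (hw : ∀ k μ ν, x k * w μ ν = h μ k * x ν + h k ν * x μ) (hx : x ≠ 0) :
    ∃ a : ℝ, ∀ μ ν, h μ ν = a * (x μ * x ν) := by
  obtain ⟨j, hj⟩ := Function.ne_iff.mp hx
  replace hj : x j ≠ 0 := hj
  have e1 : w j j = 2 * h j j := by
    apply mul_left_cancel₀ hj; linear_combination hw j j j
  have e2 : ∀ μ, h j μ * x j = x μ * h j j := fun μ => by
    linear_combination (-1/2) * hw μ j j + (1/2) * x μ * e1 - (1/2) * x j * hs μ j
  have e3 : ∀ ν, x j * w j ν = 2 * h j j * x ν := fun ν => by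
    linear_combination hw j j ν + e2 ν
  refine ⟨h j j / (x j * x j), fun μ ν => ?_⟩
  field_simp
  linear_combination -x j * hw μ j ν + x μ * e3 ν - x ν * e2 μ

lemma h_deriv_eq (h : (Fin 4 → ℝ) → Fin 4 → Fin 4 → ℝ) (x : Fin 4 → ℝ) (a : ℝ)
    (ha : ∀ μ ν, h x μ ν = a * (x μ * x ν)) (μ ν k : Fin 4)
    (hinv : ∀ A : Fin 4 → Fin 4 → ℝ, ∀ b : Fin 4 → ℝ, so13 A → lieH (xiP2 A b) h x μ ν = 0) :
    mdot x x * pdv (fun y => h y μ ν) k x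
      = a * (mdot x x * x μ * (if ν = k then 1 else 0) + mdot x x * x ν * (if μ = k then 1 else 0)
        + 2 * (epsD k * x k) * x μ * x ν) := by
  have hA : so13 (fun m n => (if m = k then 1 else 0) * (epsD n * x n)
      - x m * (if n = k then epsD n else 0)) := by
    intro m n
    simp [etaF_eq, sub_mul, mul_sub]
    split_ifs <;> subst_vars <;> ring
  have hxi : ∀ l, xiP2 (fun m n => (if m = k then 1 else 0) * (epsD n * x n)
      - x m * (if n = k then epsD n else 0)) (Pi.single k 1) x l
      = if l = k then mdot x x else 0 := by
    intro l
    simp [xiP2, mdot_eq, Pi.single_apply, sub_mul]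
    split_ifs <;> ring
  have hd : ∀ l n, pdv (fun y => xiP2 (fun m n => (if m = k then 1 else 0) * (epsD n * x n)
      - x m * (if n = k then epsD n else 0)) (Pi.single k 1) y n) l x
      = (if n = k then 1 else 0) * (epsD l * x l)
        + epsD k * x k * (if l = n then 1 else 0) := by
    intro l n
    rw [pdv_xi]
    simp [mdot_eq, Pi.single_apply]
    split_ifs <;> ring
  have hh := hinv _ (Pi.single k 1) hA
  unfold lieH at hh
  simp only [hd, hxi, ha] at hh
  have s1 : ∀ c d m n : ℝ, ∀ ρ σ : Fin 4, ∑ l, a * (x ρ * x l) * (c * (epsD l * x l)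
      + d * (if l = σ then 1 else 0)) = a * x ρ * (c * mdot x x + d * x σ) := by
    intro c d m n ρ σ
    simp only [mdot_eq, mul_add, Finset.sum_add_distrib, Finset.mul_sum]
    congr 1
    · exact Finset.sum_congr rfl fun l _ => by ring
    · simp; ring
  have s2 : ∀ c d : ℝ, ∀ ρ σ : Fin 4, ∑ l, a * (x l * x ρ) * (c * (epsD l * x l)
      + d * (if l = σ then 1 else 0)) = a * x ρ * (c * mdot x x + d * x σ) := by
    intro c d ρ σ
    rw [← s1 c d 0 0]
    exact Finset.sum_congr rfl fun l _ => by ring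
  rw [s1 _ _ 0 0, s2] at hh
  simp only [ite_mul, zero_mul, Finset.sum_ite_eq', Finset.mem_univ, if_true] at hh
  split_ifs at hh ⊢ <;> linear_combination hh

lemma hasFDeriv_sq (c : Fin 4 → ℝ) (x : Fin 4 → ℝ) :
    HasFDerivAt (fun y : Fin 4 → ℝ => ∑ k, c k * y k * y k)
      (∑ k, (2 * c k * x k) • ContinuousLinearMap.proj (R := ℝ) (φ := fun _ : Fin 4 => ℝ) k) x := by
  refine HasFDerivAt.fun_sum fun k _ => ?_
  have hc : HasFDerivAt (fun y : Fin 4 → ℝ => y k)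
      (ContinuousLinearMap.proj (R := ℝ) (φ := fun _ : Fin 4 => ℝ) k) x :=
    (ContinuousLinearMap.proj (R := ℝ) (φ := fun _ : Fin 4 => ℝ) k).hasFDerivAt
  have := (hc.const_mul (c k)).mul hc
  refine this.congr_fderiv ?_
  ext v
  simp
  ring

lemma region_preconnected : IsPreconnected {x : Fin 4 → ℝ | mdot x x < 0} := by
  have h1 : IsPreconnected (Set.Ioo (-1 : ℝ) 1) := isPreconnected_Ioo
  have h2 : IsPreconnected ({0}ᶜ : Set (EuclideanSpace ℝ (Fin 3))) := by
    apply (isConnected_compl_singleton_of_one_lt_rank _ _).isPreconnected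
    rw [← Module.finrank_eq_rank]
    simp
  have h3 := (h1.prod h2).image
    (fun p : ℝ × EuclideanSpace ℝ (Fin 3) =>
      (Fin.cons (p.1 * ‖p.2‖) (fun i => p.2 i) : Fin 4 → ℝ)) (by
      apply Continuous.continuousOn
      refine continuous_pi fun i => ?_
      refine Fin.cases ?_ (fun i => ?_) i
      · simp; fun_prop
      · simp; fun_prop)
  convert h3 using 1
  ext x
  have hx : mdot x x = x 0 ^ 2 - (x 1 ^ 2 + x 2 ^ 2 + x 3 ^ 2) := by
    simp [mdot_eq, Fin.sum_univ_four, epsD]; ring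
  simp only [Set.mem_ofPred_eq, hx, Set.mem_image, Set.mem_prod, Set.mem_Ioo,
    Set.mem_compl_iff, Set.mem_singleton_iff, Prod.exists]
  constructor
  · intro hneg
    set y : EuclideanSpace ℝ (Fin 3) := WithLp.toLp 2 (fun i => x i.succ) with hy
    have hn : ‖y‖ ^ 2 = x 1 ^ 2 + x 2 ^ 2 + x 3 ^ 2 := by
      rw [EuclideanSpace.norm_sq_eq]
      simp [Fin.sum_univ_three, hy]
    have hpos : 0 < ‖y‖ := by
      by_contra hc
      have : ‖y‖ = 0 := le_antisymm (not_lt.mp hc) (norm_nonneg _)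
      rw [this] at hn
      nlinarith [sq_nonneg (x 0)]
    have hab : |x 0| < ‖y‖ := by
      apply abs_lt_of_sq_lt_sq _ hpos.le
      linarith
    rw [abs_lt] at hab
    refine ⟨x 0 / ‖y‖, y, ⟨⟨?_, ?_⟩, norm_pos_iff.mp hpos⟩, ?_⟩
    · rw [lt_div_iff₀ hpos]; linarith
    · rw [div_lt_iff₀ hpos]; linarith
    · funext i
      refine Fin.cases ?_ (fun i => ?_) i
      · simp [hpos.ne']
      · simp [hy]
  · rintro ⟨t, y, ⟨⟨ht1, ht2⟩, hy⟩, rfl⟩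
    have hn : ‖y‖ ^ 2 = y 0 ^ 2 + y 1 ^ 2 + y 2 ^ 2 := by
      rw [EuclideanSpace.norm_sq_eq]
      simp [Fin.sum_univ_three]
    have hpos : 0 < ‖y‖ := norm_pos_iff.mpr hy
    change (t * ‖y‖) ^ 2 - (y 0 ^ 2 + y 1 ^ 2 + y 2 ^ 2) < 0
    rw [← hn]
    have : t ^ 2 < 1 := by nlinarith
    nlinarith [pow_pos hpos 2]

lemma region_open : IsOpen {x : Fin 4 → ℝ | mdot x x < 0} := by
  refine isOpen_lt ?_ continuous_const
  simp only [mdot_eq]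
  fun_prop

/-- Uniqueness of the 𝔭₂-invariant contravariant metric on the region x·x < 0. -/
theorem stmt_3 (h : (Fin 4 → ℝ) → Fin 4 → Fin 4 → ℝ)
    (hsmooth : ∀ μ ν, ContDiffOn ℝ (⊤ : ℕ∞) (fun x => h x μ ν) {x : Fin 4 → ℝ | mdot x x < 0})
    (hsym : ∀ x ∈ {x : Fin 4 → ℝ | mdot x x < 0}, ∀ μ ν, h x μ ν = h x ν μ)
    (hinv : ∀ A : Fin 4 → Fin 4 → ℝ, ∀ b : Fin 4 → ℝ, so13 A →
      ∀ x ∈ {x : Fin 4 → ℝ | mdot x x < 0}, ∀ μ ν, lieH (xiP2 A b) h x μ ν = 0) :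
    ∃ C : ℝ, ∀ x ∈ {x : Fin 4 → ℝ | mdot x x < 0}, ∀ μ ν,
      h x μ ν = C * (mdot x x * x μ * x ν) := by

  have hne : ∀ x ∈ {x : Fin 4 → ℝ | mdot x x < 0}, x ≠ 0 := by
    rintro x hx rfl
    simp [mdot] at hx
  have hrank : ∀ x ∈ {x : Fin 4 → ℝ | mdot x x < 0},
      ∃ a : ℝ, ∀ μ ν, h x μ ν = a * (x μ * x ν) := fun x hx =>
    rank_one (h x) (fun μ ν => (∑ l, x l * pdv (fun y => h y μ ν) l x) - 2 * h x μ ν) x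
      (hsym x hx)
      (fun k μ ν => struct_eq h x μ ν k (hinv _ _ (by intro m n; simp) x hx μ ν)) (hne x hx)
  have hNpos : ∀ x ∈ {x : Fin 4 → ℝ | mdot x x < 0}, 0 < ∑ k, (1 : ℝ) * x k * x k := by
    intro x hx
    obtain ⟨j, hj⟩ := Function.ne_iff.mp (hne x hx)
    refine Finset.sum_pos' (fun i _ => ?_) ⟨j, Finset.mem_univ _, ?_⟩
    · rw [one_mul]; exact mul_self_nonneg _
    · rw [one_mul]; exact mul_self_pos.mpr hj
  have hdiff : ∀ x ∈ {x : Fin 4 → ℝ | mdot x x < 0}, ∀ μ ν,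
      DifferentiableAt ℝ (fun y => h y μ ν) x := fun x hx μ ν =>
    ((hsmooth μ ν).contDiffAt (region_open.mem_nhds hx)).differentiableAt (by simp)
  set f : (Fin 4 → ℝ) → ℝ := fun y =>
    (∑ m, h y m m) * ((∑ k, epsD k * y k * y k) * (∑ k, (1 : ℝ) * y k * y k))⁻¹ with hf
  have hfd : ∀ x ∈ {x : Fin 4 → ℝ | mdot x x < 0}, HasFDerivAt f (0 : (Fin 4 → ℝ) →L[ℝ] ℝ) x := by
    intro x hx
    obtain ⟨a, ha⟩ := hrank x hx
    have hs : mdot x x ≠ 0 := ne_of_lt hx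
    have hN := (hNpos x hx).ne'
    have hT : HasFDerivAt (fun y : Fin 4 → ℝ => ∑ m, h y m m)
        (∑ m, fderiv ℝ (fun y : Fin 4 → ℝ => h y m m) x) x :=
      HasFDerivAt.fun_sum fun m _ => (hdiff x hx m m).hasFDerivAt
    have hD := (hasFDeriv_sq epsD x).mul (hasFDeriv_sq (fun _ => 1) x)
    have hD0 : (∑ k, epsD k * x k * x k) * (∑ k, (1 : ℝ) * x k * x k) ≠ 0 := by
      rw [← mdot_eq]; exact mul_ne_zero hs hN
    have hq := hT.mul ((hasDerivAt_inv hD0).comp_hasFDerivAt x hD)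
    refine hq.congr_fderiv ?_
    apply ContinuousLinearMap.coe_injective
    apply LinearMap.pi_ext'
    intro k
    ext
    have key : mdot x x * ∑ m, fderiv ℝ (fun y => h y m m) x (Pi.single k 1)
        = a * (2 * mdot x x * x k + 2 * (epsD k * x k) * ∑ k, 1 * x k * x k) := by
      have := fun m => h_deriv_eq h x a ha m m k (fun A b hA => hinv A b hA x hx m m)
      simp only [pdv] at this
      rw [Finset.mul_sum, Finset.sum_congr rfl fun m _ => this m, ← Finset.mul_sum]
      simp only [Finset.sum_add_distrib, Finset.mul_sum]
      simp [mul_assoc]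
      left
      ring
    have hTr : ∑ m, h x m m = a * ∑ k, 1 * x k * x k := by
      rw [Finset.mul_sum]
      exact Finset.sum_congr rfl fun m _ => by rw [ha]; ring
    simp only [← mdot_eq, hTr]
    simp [Pi.single_apply] at key hN ⊢
    generalize (∑ m, x m * x m) = N at key hN ⊢
    generalize (∑ m, fderiv ℝ (fun y => h y m m) x (Pi.single k 1)) = F at key ⊢
    generalize mdot x x = s at key hs ⊢
    have hF : F = a * (2 * s * x k + 2 * (epsD k * x k) * N) / s := by
      rw [eq_div_iff hs]; linear_combination key
    rw [hF]
    field_simp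
    ring
  have hconst : ∃ C, ∀ x ∈ {x : Fin 4 → ℝ | mdot x x < 0}, f x = C := by
    exact
    region_open.exists_is_const_of_fderiv_eq_zero region_preconnected
      (fun x hx => (hfd x hx).differentiableAt.differentiableWithinAt)
      (fun x hx => HasFDerivAt.fderiv (hfd x hx))
  obtain ⟨C, hC⟩ := hconst
  refine ⟨C, fun x hx μ ν => ?_⟩
  obtain ⟨a, ha⟩ := hrank x hx
  have hs : mdot x x ≠ 0 := ne_of_lt hx
  have hN := (hNpos x hx).ne'
  have hTr : ∑ m, h x m m = a * ∑ k, 1 * x k * x k := by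
    rw [Finset.mul_sum]
    exact Finset.sum_congr rfl fun m _ => by rw [ha]; ring
  have h1 := hC x hx
  simp only [hf, ← mdot_eq, hTr] at h1
  rw [← div_eq_mul_inv, div_eq_iff (mul_ne_zero hs hN)] at h1
  have h2 : a = C * mdot x x := mul_right_cancel₀ hN (by rw [h1]; ring)
  rw [ha, h2]; ring
end
end

section
/- Invariance of the canonical connection under the second Poincaré algebra: let U = {x ∈ ℝ⁴ : x·x ≠ 0} and define Γ^μ_{νλ}(x) = −(x_ν δ^μ_λ + δ^μ_ν x_λ)/(x·x) on U. Then for every 𝔭₂ vector field ξ(x) = A x + (b·x) x (with A ∈ 𝔰𝔬(1,3) and b ∈ ℝ⁴), the Lie derivative of the connection along ξ vanishes on U: ξ^λ ∂_λ Γ^μ_{νρ} − Γ^λ_{νρ} ∂_λ ξ^μ + Γ^μ_{λρ} ∂_ν ξ^λ + Γ^μ_{νλ} ∂_ρ ξ^λ + ∂_ν ∂_ρ ξ^μ = 0 for all μ, ν, ρ. -/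
noncomputable section

open scoped BigOperators

lemma aux_mdot (x y : Fin 4 → ℝ) : mdot x y = x 0 * y 0 - x 1 * y 1 - x 2 * y 2 - x 3 * y 3 := by
  simp [mdot, etaF, Fin.sum_univ_four]; ring

lemma aux_lowr (x : Fin 4 → ℝ) (μ : Fin 4) : lowr x μ = (if μ = 0 then 1 else -1) * x μ := by
  simp [lowr, etaF]

lemma aux_coord (k : Fin 4) (x : Fin 4 → ℝ) :
    HasFDerivAt (fun y : Fin 4 → ℝ => y k) (ContinuousLinearMap.proj (R := ℝ) k) x :=
  hasFDerivAt_apply k x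

lemma aux_lin (c : Fin 4 → ℝ) (x : Fin 4 → ℝ) :
    HasFDerivAt (fun y : Fin 4 → ℝ => ∑ k, c k * y k)
      (∑ k, c k • (ContinuousLinearMap.proj (R := ℝ) (φ := fun _ : Fin 4 => ℝ) k)) x := by
  apply HasFDerivAt.fun_sum
  intro k _
  exact (aux_coord k x).const_mul (c k)

lemma aux_mdot_sum (b x : Fin 4 → ℝ) : mdot b x = ∑ k, lowr b k * x k := by
  simp [aux_mdot, aux_lowr, Fin.sum_univ_four]; ring

lemma aux_pdv_xi (A : Fin 4 → Fin 4 → ℝ) (b : Fin 4 → ℝ) (μ ν : Fin 4) (x : Fin 4 → ℝ) :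
    pdv (fun y => xiP2 A b y μ) ν x
      = A μ ν + lowr b ν * x μ + mdot b x * (if μ = ν then 1 else 0) := by
  have h := (aux_lin (A μ) x).add ((aux_lin (lowr b) x).mul (aux_coord μ x))
  have e : (fun y => xiP2 A b y μ) = (fun y => (∑ k, A μ k * y k) + (∑ k, lowr b k * y k) * y μ) := by
    funext y; simp only [xiP2, aux_mdot_sum]
  rw [pdv, e]
  erw [h.fderiv]
  rw [aux_mdot_sum]
  simp [Pi.single_apply]
  ring

lemma aux_pdv2_xi (A : Fin 4 → Fin 4 → ℝ) (b : Fin 4 → ℝ) (μ ν ρ : Fin 4) (x : Fin 4 → ℝ) :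
    pdv (fun y => pdv (fun z => xiP2 A b z μ) ρ y) ν x
      = lowr b ρ * (if μ = ν then 1 else 0) + lowr b ν * (if μ = ρ then 1 else 0) := by
  have h := (((aux_coord μ x).const_mul (lowr b ρ)).const_add (A μ ρ)).add
    ((aux_lin (lowr b) x).mul_const (if μ = ρ then (1:ℝ) else 0))
  have e : (fun y => pdv (fun z => xiP2 A b z μ) ρ y) = (fun y => (A μ ρ + lowr b ρ * y μ) +
      (∑ k, lowr b k * y k) * (if μ = ρ then (1:ℝ) else 0)) := by
    funext y; rw [aux_pdv_xi, aux_mdot_sum]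
  rw [pdv, e]
  erw [h.fderiv]
  split_ifs <;> simp_all [Pi.single_apply]

lemma aux_pdv_G (x : Fin 4 → ℝ) (hx : mdot x x ≠ 0) (μ ν ρ l : Fin 4) :
    pdv (fun y => GammaC y μ ν ρ) l x
      = -(etaF ν l * (if μ = ρ then 1 else 0) + (if μ = ν then 1 else 0) * etaF ρ l) / mdot x x
        + (lowr x ν * (if μ = ρ then 1 else 0) + (if μ = ν then 1 else 0) * lowr x ρ)
          * (2 * lowr x l) / (mdot x x) ^ 2 := by
  have hs : HasFDerivAt (fun y => mdot y y)
      (∑ k, (2 * lowr x k) • (ContinuousLinearMap.proj (R := ℝ) (φ := fun _ : Fin 4 => ℝ) k)) x := by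
    have h := ((((aux_coord 0 x).mul (aux_coord 0 x)).sub ((aux_coord 1 x).mul (aux_coord 1 x))).sub
      ((aux_coord 2 x).mul (aux_coord 2 x))).sub ((aux_coord 3 x).mul (aux_coord 3 x))
    have e : (fun y => mdot y y) = (fun y : Fin 4 → ℝ => y 0 * y 0 - y 1 * y 1 - y 2 * y 2 - y 3 * y 3) := by
      funext y; rw [aux_mdot]
    rw [e]
    refine h.congr_fderiv ?_
    ext v
    simp [aux_lowr, Fin.sum_univ_four]
    ring
  have hl : ∀ k, HasFDerivAt (fun y => lowr y k)
      (∑ j, etaF k j • (ContinuousLinearMap.proj (R := ℝ) (φ := fun _ : Fin 4 => ℝ) j)) x :=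
    fun k => aux_lin (etaF k) x
  have hi : HasFDerivAt (fun y => (mdot y y)⁻¹) _ x := HasDerivAt.comp_hasFDerivAt (h₂ := fun t : ℝ => t⁻¹) (f := fun y => mdot y y) x
    (hasDerivAt_inv hx) hs
  have h := ((((hl ν).mul_const (if μ = ρ then (1:ℝ) else 0)).add
    ((hl ρ).const_mul (if μ = ν then (1:ℝ) else 0))).neg).mul hi
  have e : (fun y => GammaC y μ ν ρ) = (fun y => -(lowr y ν * (if μ = ρ then (1:ℝ) else 0) + (if μ = ν then 1 else 0) * lowr y ρ) * (mdot y y)⁻¹) := by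
    funext y; simp only [GammaC, div_eq_mul_inv]
  rw [pdv, e]
  erw [h.fderiv]
  clear h e
  generalize (if μ = ρ then (1:ℝ) else 0) = d1
  generalize (if μ = ν then (1:ℝ) else 0) = d2
  simp [Pi.single_apply]
  field_simp
  ring

lemma aux_skew (A : Fin 4 → Fin 4 → ℝ) (hA : so13 A) (x : Fin 4 → ℝ) (ν : Fin 4) :
    ∑ l, lowr x l * A l ν = - lowr (fun m => ∑ k, A m k * x k) ν := by
  have h : ∀ k, (if k = 0 then (1:ℝ) else -1) * A k ν = - ((if ν = 0 then (1:ℝ) else -1) * A ν k) := by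
    intro k
    have := hA k ν
    simp [etaF] at this
    split_ifs at * <;> linarith
  rw [aux_lowr, Finset.mul_sum, ← Finset.sum_neg_distrib]
  refine Finset.sum_congr rfl fun k _ => ?_
  rw [aux_lowr]
  linear_combination x k * h k

lemma aux_skew2 (A : Fin 4 → Fin 4 → ℝ) (hA : so13 A) (x : Fin 4 → ℝ) :
    ∑ l, (∑ k, A l k * x k) * lowr x l = 0 := by
  have h1 : ∑ l, (∑ k, A l k * x k) * lowr x l = ∑ k, (∑ l, lowr x l * A l k) * x k := by
    simp only [Finset.sum_mul]
    rw [Finset.sum_comm]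
    refine Finset.sum_congr rfl fun k _ => Finset.sum_congr rfl fun l _ => by ring
  have h2 : ∑ k, (∑ l, lowr x l * A l k) * x k = - ∑ l, (∑ k, A l k * x k) * lowr x l := by
    rw [← Finset.sum_neg_distrib]
    refine Finset.sum_congr rfl fun k _ => ?_
    rw [aux_skew A hA, aux_lowr, aux_lowr]; ring
  linarith

lemma aux_contr (A : Fin 4 → Fin 4 → ℝ) (hA : so13 A) (b x : Fin 4 → ℝ) (ν : Fin 4) :
    ∑ l, lowr x l * (A l ν + lowr b ν * x l + mdot b x * (if l = ν then 1 else 0))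
      = - lowr (fun m => ∑ k, A m k * x k) ν + mdot x x * lowr b ν + mdot b x * lowr x ν := by
  rw [← aux_skew A hA, aux_mdot_sum x x]
  simp only [mul_add, Finset.sum_add_distrib, Finset.sum_mul]
  congr 1
  · congr 1
    exact Finset.sum_congr rfl fun k _ => by ring
  · simp [mul_comm]

/-- Invariance of the canonical connection Γ^μ_{νλ} under the second Poincaré algebra. -/
theorem stmt_9 (A : Fin 4 → Fin 4 → ℝ) (hA : so13 A) (b : Fin 4 → ℝ) :
    ∀ x : Fin 4 → ℝ, mdot x x ≠ 0 → ∀ μ ν ρ, lieConn (xiP2 A b) GammaC x μ ν ρ = 0 := by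
  intro x hx μ ν ρ
  have hxi : ∀ σ, ∑ l, xiP2 A b x l * etaF σ l
      = lowr (fun m => ∑ k, A m k * x k) σ + mdot b x * lowr x σ := by
    intro σ
    simp only [lowr, xiP2, Finset.mul_sum, ← Finset.sum_add_distrib]
    exact Finset.sum_congr rfl fun k _ => by rw [← Finset.mul_sum]; ring
  have hxx : ∑ l, xiP2 A b x l * lowr x l = mdot b x * mdot x x := by
    have := aux_skew2 A hA x
    have h2 : ∑ l, xiP2 A b x l * lowr x l
        = ∑ l, (∑ k, A l k * x k) * lowr x l + mdot b x * ∑ k, lowr x k * x k := by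
      rw [Finset.mul_sum, ← Finset.sum_add_distrib]
      exact Finset.sum_congr rfl fun k _ => by rw [xiP2]; ring
    rw [h2, this, zero_add, ← aux_mdot_sum]
  have T1 : ∑ l, xiP2 A b x l * pdv (fun y => GammaC y μ ν ρ) l x
      = -((∑ l, xiP2 A b x l * etaF ν l) * (if μ = ρ then 1 else 0)
          + (if μ = ν then 1 else 0) * ∑ l, xiP2 A b x l * etaF ρ l) / mdot x x
        + (lowr x ν * (if μ = ρ then 1 else 0) + (if μ = ν then 1 else 0) * lowr x ρ)
          * (2 * ∑ l, xiP2 A b x l * lowr x l) / (mdot x x) ^ 2 := by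
    simp only [aux_pdv_G x hx, Fin.sum_univ_four]
    ring
  have T2 : ∀ f : Fin 4 → ℝ, ∑ l, GammaC x l ν ρ * f l
      = -(lowr x ν * f ρ + lowr x ρ * f ν) / mdot x x := by
    intro f
    have : ∀ l, GammaC x l ν ρ * f l = (if l = ρ then -(lowr x ν * f l) / mdot x x else 0)
        + (if l = ν then -(lowr x ρ * f l) / mdot x x else 0) := by
      intro l; rw [GammaC]; split_ifs <;> ring
    simp only [this, Finset.sum_add_distrib, Finset.sum_ite_eq', Finset.mem_univ, if_true]
    ring
  have T3 : ∀ (σ : Fin 4) (f : Fin 4 → ℝ), ∑ l, GammaC x μ l σ * f l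
      = -((if μ = σ then 1 else 0) * (∑ l, lowr x l * f l) + lowr x σ * f μ) / mdot x x := by
    intro σ f
    have : ∀ l, GammaC x μ l σ * f l
        = -((if μ = σ then 1 else 0) / mdot x x) * (lowr x l * f l)
        + (if μ = l then -(lowr x σ * f l) / mdot x x else 0) := by
      intro l; rw [GammaC]; split_ifs <;> ring
    simp only [this, Finset.sum_add_distrib, Finset.sum_ite_eq, Finset.mem_univ, if_true,
      ← Finset.mul_sum]
    ring
  have hsym : ∀ l, GammaC x μ ν l = GammaC x μ l ν := by
    intro l; simp only [GammaC]; ring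
  rw [lieConn, T1, hxi, hxi, hxx]
  simp only [hsym]
  rw [T2, T3, T3, aux_pdv2_xi]
  simp only [aux_pdv_xi, aux_contr A hA]
  field_simp
  ring
end
end
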